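/- Fix an integer n ≥ 1 and a real J > 0, and let H_eff = (J/(2n)) ∑_{1≤i<j≤n} ∑_{α,β∈{x,y,z}} (σ_{iL}^α σ_{jL}^β − σ_{iR}^α σ_{jR}^β)². For each i choose ψ_i ∈ {|s⟩, |t⟩, |00⟩, |11⟩} in the pair factor ℂ²_{iL}⊗ℂ²_{iR}, and let z = #{i : ψ_i ≠ |s⟩}. Then ⊗_{i=1}^n ψ_i is an eigenvector of H_eff with eigenvalue 4Jz(3n−2z−1)/n. In particular the all-singlet state ⊗_i |s⟩ has eigenvalue 0. -/

import Mathlib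

open scoped BigOperators

/-- The Pauli matrices `σ^x, σ^y, σ^z`, indexed by `Fin 3`. -/
noncomputable def pauli : Fin 3 → Matrix (Fin 2) (Fin 2) ℂ
  | 0 => !![0, 1; 1, 0]
  | 1 => !![0, -Complex.I; Complex.I, 0]
  | 2 => !![1, 0; 0, -1]

/-- Single-site operator acting as `M` on qubit `q` of `(ℂ²)^{⊗2n}` (qubits labelled
`(i,a)`, `a = false` for `L`, `a = true` for `R`) and as the identity elsewhere. -/
noncomputable def siteOp (n : ℕ) (q : Fin n × Bool) (M : Matrix (Fin 2) (Fin 2) ℂ) :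
    Matrix ((Fin n × Bool) → Fin 2) ((Fin n × Bool) → Fin 2) ℂ :=
  Matrix.of fun x y =>
    (if ∀ p : Fin n × Bool, p ≠ q → x p = y p then (1 : ℂ) else 0) * M (x q) (y q)

/-- The effective Hamiltonian
`H_eff = (J/(2n)) ∑_{i<j} ∑_{α,β} (σ_{iL}^α σ_{jL}^β − σ_{iR}^α σ_{jR}^β)²`. -/
noncomputable def Heff (n : ℕ) (J : ℝ) :
    Matrix ((Fin n × Bool) → Fin 2) ((Fin n × Bool) → Fin 2) ℂ :=
  ((J / (2 * n) : ℝ) : ℂ) •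
    ∑ i : Fin n, ∑ j : Fin n,
      if i < j then
        ∑ α : Fin 3, ∑ β : Fin 3,
          (siteOp n (i, false) (pauli α) * siteOp n (j, false) (pauli β) -
            siteOp n (i, true) (pauli α) * siteOp n (j, true) (pauli β)) ^ 2
      else 0

/-- The singlet state `|s⟩ = (|01⟩ − |10⟩)/√2` of a pair of qubits. -/
noncomputable def singlet : Fin 2 × Fin 2 → ℂ := fun p =>
  ((if p = (0, 1) then (1 : ℂ) else 0) - (if p = (1, 0) then (1 : ℂ) else 0)) / (Real.sqrt 2 : ℂ)

/-- The triplet state `|t⟩ = (|01⟩ + |10⟩)/√2` of a pair of qubits. -/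
noncomputable def triplet : Fin 2 × Fin 2 → ℂ := fun p =>
  ((if p = (0, 1) then (1 : ℂ) else 0) + (if p = (1, 0) then (1 : ℂ) else 0)) / (Real.sqrt 2 : ℂ)

/-- The computational basis state `|ab⟩` of a pair of qubits. -/
noncomputable def ketPair (a b : Fin 2) : Fin 2 × Fin 2 → ℂ := fun p =>
  if p = (a, b) then 1 else 0

/-- The product state `⊗_{i=1}^n ψ_i`, where `ψ_i` is a state of the pair factor
`ℂ²_{iL} ⊗ ℂ²_{iR}`. -/
noncomputable def prodState (n : ℕ) (ψ : Fin n → (Fin 2 × Fin 2 → ℂ)) :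
    ((Fin n × Bool) → Fin 2) → ℂ :=
  fun x => ∏ i : Fin n, ψ i (x (i, false), x (i, true))

open scoped Matrix

/-- A single-site operator acts on a state by contracting the coordinate of its qubit. -/
lemma siteOp_mulVec (n : ℕ) (q : Fin n × Bool) (M : Matrix (Fin 2) (Fin 2) ℂ)
    (v : ((Fin n × Bool) → Fin 2) → ℂ) (x : (Fin n × Bool) → Fin 2) :
    (siteOp n q M *ᵥ v) x = ∑ c, M (x q) c * v (Function.update x q c) := by
  simp only [Matrix.mulVec, dotProduct, siteOp, Matrix.of_apply]
  have himage : ∀ y ∉ Finset.univ.image (fun c : Fin 2 => Function.update x q c),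
      (if ∀ p : Fin n × Bool, p ≠ q → x p = y p then (1 : ℂ) else 0) * M (x q) (y q) * v y
        = 0 := by
    intro y hy
    rw [if_neg, zero_mul, zero_mul]
    intro h
    refine hy (Finset.mem_image.2 ⟨y q, Finset.mem_univ _, ?_⟩)
    ext p
    by_cases hp : p = q
    · subst hp; simp
    · simp [hp, h p hp]
  rw [← Finset.sum_subset (Finset.subset_univ _) fun y _ hy => himage y hy,
    Finset.sum_image fun a _ b _ hab => Function.update_injective x q hab]
  refine Finset.sum_congr rfl fun c _ => ?_
  rw [if_pos fun p hp => by simp [hp]]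
  simp

lemma siteOp_one (n : ℕ) (q : Fin n × Bool) : siteOp n q 1 = 1 := by
  refine Matrix.ext_of_mulVec_single fun y => ?_
  ext x
  rw [siteOp_mulVec, Matrix.one_mulVec]
  simp [Matrix.one_apply, -Fin.sum_univ_two]

lemma siteOp_mul_siteOp (n : ℕ) (q : Fin n × Bool) (M N : Matrix (Fin 2) (Fin 2) ℂ) :
    siteOp n q M * siteOp n q N = siteOp n q (M * N) := by
  refine Matrix.ext_of_mulVec_single fun y => ?_
  ext x
  rw [← Matrix.mulVec_mulVec]
  simp only [siteOp_mulVec, Function.update_self, Function.update_idem, Matrix.mul_apply,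
    Finset.sum_mul, Finset.mul_sum, ← mul_assoc]
  exact Finset.sum_comm

lemma siteOp_commute (n : ℕ) {p q : Fin n × Bool} (hpq : p ≠ q)
    (M N : Matrix (Fin 2) (Fin 2) ℂ) : Commute (siteOp n p M) (siteOp n q N) := by
  refine Matrix.ext_of_mulVec_single fun y => ?_
  ext x
  rw [← Matrix.mulVec_mulVec, ← Matrix.mulVec_mulVec]
  simp only [siteOp_mulVec, Function.update_of_ne hpq, Function.update_of_ne hpq.symm,
    Finset.mul_sum]
  rw [Finset.sum_comm]
  refine Finset.sum_congr rfl fun c _ => Finset.sum_congr rfl fun d _ => ?_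
  rw [Function.update_comm hpq]
  ring

lemma pauli_mul_self (α : Fin 3) : pauli α * pauli α = 1 := by
  fin_cases α <;> ext a b <;> fin_cases a <;> fin_cases b <;>
    simp [pauli, Matrix.mul_apply]

lemma siteOp_pauli_mul_self (n : ℕ) (q : Fin n × Bool) (α : Fin 3) :
    siteOp n q (pauli α) * siteOp n q (pauli α) = 1 := by
  rw [siteOp_mul_siteOp, pauli_mul_self, siteOp_one]

/-- The exchange operator `∑_α σ_{iL}^α σ_{iR}^α` of the `i`-th pair. -/
noncomputable def pairExchange (n : ℕ) (i : Fin n) :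
    Matrix ((Fin n × Bool) → Fin 2) ((Fin n × Bool) → Fin 2) ℂ :=
  ∑ α : Fin 3, siteOp n (i, false) (pauli α) * siteOp n (i, true) (pauli α)

lemma sq_sub_of_commuting_involutions {R : Type*} [Ring R] {a b c d : R}
    (ha : a * a = 1) (hb : b * b = 1) (hc : c * c = 1) (hd : d * d = 1)
    (hab : Commute a b) (hac : Commute a c) (had : Commute a d)
    (hbc : Commute b c) (hbd : Commute b d) (hcd : Commute c d) :
    (a * b - c * d) ^ 2 = 2 - 2 * ((a * c) * (b * d)) := by
  have hfst : (a * b) * (a * b) = 1 := by rw [hab.symm.mul_mul_mul_comm, ha, hb, one_mul]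
  have hsnd : (c * d) * (c * d) = 1 := by rw [hcd.symm.mul_mul_mul_comm, hc, hd, one_mul]
  have hcomm : Commute (a * b) (c * d) :=
    (hac.mul_right had).mul_left (hbc.mul_right hbd)
  rw [hbc.symm.mul_mul_mul_comm, sq, sub_mul, mul_sub, mul_sub, hfst, hsnd, ← hcomm.eq]
  rw [two_mul, ← one_add_one_eq_two]
  abel

lemma sum_sq_eq_pairExchange (n : ℕ) {i j : Fin n} (hij : i ≠ j) :
    ∑ α : Fin 3, ∑ β : Fin 3,
      (siteOp n (i, false) (pauli α) * siteOp n (j, false) (pauli β) -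
        siteOp n (i, true) (pauli α) * siteOp n (j, true) (pauli β)) ^ 2 =
      18 - 2 * (pairExchange n i * pairExchange n j) := by
  have hterm : ∀ α β : Fin 3,
      (siteOp n (i, false) (pauli α) * siteOp n (j, false) (pauli β) -
        siteOp n (i, true) (pauli α) * siteOp n (j, true) (pauli β)) ^ 2 =
      2 - 2 * ((siteOp n (i, false) (pauli α) * siteOp n (i, true) (pauli α)) *
        (siteOp n (j, false) (pauli β) * siteOp n (j, true) (pauli β))) := fun α β =>
    sq_sub_of_commuting_involutions
      (siteOp_pauli_mul_self ..) (siteOp_pauli_mul_self ..)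
      (siteOp_pauli_mul_self ..) (siteOp_pauli_mul_self ..)
      (siteOp_commute n (by simp [hij]) _ _) (siteOp_commute n (by simp) _ _)
      (siteOp_commute n (by simp) _ _) (siteOp_commute n (by simp) _ _)
      (siteOp_commute n (by simp) _ _) (siteOp_commute n (by simp [hij]) _ _)
  simp only [hterm, pairExchange, Finset.sum_sub_distrib, ← Finset.mul_sum, ← Finset.sum_mul]
  congr 1
  simp
  norm_num

lemma prodState_update_pair (n : ℕ) (ψ : Fin n → (Fin 2 × Fin 2 → ℂ)) (i : Fin n)
    (x : (Fin n × Bool) → Fin 2) (a b : Fin 2) :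
    prodState n ψ (Function.update (Function.update x (i, false) a) (i, true) b) =
      ψ i (a, b) * ∏ j ∈ Finset.univ.erase i, ψ j (x (j, false), x (j, true)) := by
  rw [prodState, ← Finset.mul_prod_erase _ _ (Finset.mem_univ i)]
  congr 1
  · simp
  · refine Finset.prod_congr rfl fun j hj => ?_
    simp [Finset.ne_of_mem_erase hj]

/-- If `ψ_i` is an eigenvector of `∑_α σ^α ⊗ σ^α`, then `⊗_i ψ_i` is an eigenvector of
the exchange operator of the `i`-th pair with the same eigenvalue. -/
lemma pairExchange_mulVec_prodState (n : ℕ) (ψ : Fin n → (Fin 2 × Fin 2 → ℂ)) (i : Fin n)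
    (μ : ℂ)
    (hμ : ∀ a b : Fin 2,
      ∑ α : Fin 3, ∑ c, ∑ d, pauli α a c * pauli α b d * ψ i (c, d) = μ * ψ i (a, b)) :
    pairExchange n i *ᵥ prodState n ψ = μ • prodState n ψ := by
  ext x
  have hx : prodState n ψ x = ψ i (x (i, false), x (i, true)) *
      ∏ j ∈ Finset.univ.erase i, ψ j (x (j, false), x (j, true)) :=
    (Finset.mul_prod_erase _ _ (Finset.mem_univ i)).symm
  rw [Pi.smul_apply, smul_eq_mul, hx, ← mul_assoc, ← hμ]
  simp only [pairExchange, Matrix.sum_mulVec, Finset.sum_apply, ← Matrix.mulVec_mulVec,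
    siteOp_mulVec, prodState_update_pair, Finset.sum_mul, Finset.mul_sum]
  refine Finset.sum_congr rfl fun α _ => Finset.sum_congr rfl fun c _ =>
    Finset.sum_congr rfl fun d _ => ?_
  simp
  ring

lemma pauli_exchange_singlet (a b : Fin 2) :
    ∑ α : Fin 3, ∑ c, ∑ d, pauli α a c * pauli α b d * singlet (c, d) =
      -3 * singlet (a, b) := by
  fin_cases a <;> fin_cases b <;>
    simp [Fin.sum_univ_succ, pauli, singlet] <;> ring

lemma pauli_exchange_triplet (a b : Fin 2) :
    ∑ α : Fin 3, ∑ c, ∑ d, pauli α a c * pauli α b d * triplet (c, d) =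
      1 * triplet (a, b) := by
  fin_cases a <;> fin_cases b <;>
    simp [Fin.sum_univ_succ, pauli, triplet]

lemma pauli_exchange_ketPair_self (e a b : Fin 2) :
    ∑ α : Fin 3, ∑ c, ∑ d, pauli α a c * pauli α b d * ketPair e e (c, d) =
      1 * ketPair e e (a, b) := by
  fin_cases e <;> fin_cases a <;> fin_cases b <;>
    simp [Fin.sum_univ_succ, pauli, ketPair]

lemma Finset.two_mul_sum_lt_of_symm {R : Type*} [CommRing R] {n : ℕ} (f : Fin n → Fin n → R)
    (hf : ∀ i j, f i j = f j i) :
    2 * ∑ i, ∑ j, (if i < j then f i j else 0) = ∑ i, ∑ j, f i j - ∑ i, f i i := by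
  have hswap : ∑ i, ∑ j, (if i < j then f i j else 0) =
      ∑ i, ∑ j, (if j < i then f i j else 0) := by
    rw [Finset.sum_comm]
    simp only [hf]
  have hdiag : ∑ i, f i i = ∑ i, ∑ j, (if i = j then f i j else 0) := by simp
  rw [two_mul, hdiag]
  nth_rewrite 2 [hswap]
  simp only [← Finset.sum_add_distrib, ← Finset.sum_sub_distrib]
  refine Finset.sum_congr rfl fun i _ => Finset.sum_congr rfl fun j _ => ?_
  rcases lt_trichotomy i j with h | h | h
  · simp [h, h.not_gt, h.ne]
  · simp [h]
  · simp [h, h.not_gt, h.ne.symm]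

/-- The sum over pairs of the local eigenvalues, where `t i` is the indicator of
`i` carrying a non-singlet state. -/
lemma sum_pair_eigenvalues {n : ℕ} (t : Fin n → ℂ) (ht : ∀ i, t i * t i = t i) :
    ∑ i, ∑ j, (if i < j then 18 - 2 * ((4 * t i - 3) * (4 * t j - 3)) else 0) =
      8 * (∑ i, t i) * (3 * n - 2 * (∑ i, t i) - 1) := by
  have hsum := Finset.two_mul_sum_lt_of_symm
    (fun i j => 18 - 2 * ((4 * t i - 3) * (4 * t j - 3))) fun i j => by ring
  have hexpand : ∀ i j, 18 - 2 * ((4 * t i - 3) * (4 * t j - 3)) =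
      24 * t i + 24 * t j - 32 * (t i * t j) := fun i j => by ring
  simp only [hexpand, ht] at hsum ⊢
  simp only [Finset.sum_add_distrib, Finset.sum_sub_distrib, ← Finset.mul_sum,
    ← Finset.sum_mul, Finset.sum_const, Finset.card_univ, Fintype.card_fin, nsmul_eq_mul] at hsum
  linear_combination hsum / 2

/-- A product of eigenvectors of the pair exchange operators, with eigenvalues `4 t_i - 3`
for `t_i ∈ {0, 1}`, is an eigenvector of `H_eff`. -/
lemma Heff_mulVec_of_pairExchange (n : ℕ) (J : ℝ) (v : ((Fin n × Bool) → Fin 2) → ℂ)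
    (t : Fin n → ℂ) (ht : ∀ i, t i * t i = t i)
    (hv : ∀ i, pairExchange n i *ᵥ v = (4 * t i - 3) • v) :
    Heff n J *ᵥ v = (((J / (2 * n) : ℝ) : ℂ) *
      (8 * (∑ i, t i) * (3 * n - 2 * (∑ i, t i) - 1))) • v := by
  rw [Heff, Matrix.smul_mulVec, mul_smul, ← sum_pair_eigenvalues t ht]
  simp only [Matrix.sum_mulVec, Finset.sum_smul]
  congr 1
  refine Finset.sum_congr rfl fun i _ => Finset.sum_congr rfl fun j _ => ?_
  split_ifs with hij
  · have hnat : ∀ k : ℕ, [k.AtLeastTwo] → ∀ w : ((Fin n × Bool) → Fin 2) → ℂ,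
        (OfNat.ofNat k : Matrix ((Fin n × Bool) → Fin 2) ((Fin n × Bool) → Fin 2) ℂ) *ᵥ w =
          (OfNat.ofNat k : ℂ) • w := fun k _ w => Matrix.ofNat_mulVec k w
    rw [sum_sq_eq_pairExchange n hij.ne, Matrix.sub_mulVec, ← Matrix.mulVec_mulVec,
      ← Matrix.mulVec_mulVec, hv j, Matrix.mulVec_smul, hv i, hnat, hnat]
    module
  · simp

open scoped Classical in
/-- if each `ψ_i ∈ {|s⟩, |t⟩, |00⟩, |11⟩}` and `z = #{i : ψ_i ≠ |s⟩}`, then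
`⊗_i ψ_i` is an eigenvector of `H_eff` with eigenvalue `4Jz(3n−2z−1)/n`; in particular the
all-singlet state has eigenvalue `0`. -/
theorem Heff_eigenvector (n : ℕ) (hn : 1 ≤ n) (J : ℝ) (hJ : 0 < J)
    (ψ : Fin n → (Fin 2 × Fin 2 → ℂ))
    (hψ : ∀ i, ψ i = singlet ∨ ψ i = triplet ∨ ψ i = ketPair 0 0 ∨ ψ i = ketPair 1 1)
    (z : ℕ) (hz : z = (Finset.univ.filter fun i => ψ i ≠ singlet).card) :
    (Heff n J).mulVec (prodState n ψ) =
      ((4 * J * (z : ℝ) * (3 * (n : ℝ) - 2 * (z : ℝ) - 1) / (n : ℝ) : ℝ) : ℂ) •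
        prodState n ψ := by
  classical
  have heigen : ∀ i, pairExchange n i *ᵥ prodState n ψ =
      (4 * (if ψ i ≠ singlet then (1 : ℂ) else 0) - 3) • prodState n ψ := by
    intro i
    refine pairExchange_mulVec_prodState n ψ i _ fun a b => ?_
    by_cases hs : ψ i = singlet
    · rw [if_neg (not_not.2 hs), hs, pauli_exchange_singlet]
      norm_num
    · rw [if_pos hs, show (4 * 1 - 3 : ℂ) = 1 by norm_num]
      rcases hψ i with h | h | h | h
      · exact absurd h hs
      · rw [h, pauli_exchange_triplet]
      · rw [h, pauli_exchange_ketPair_self]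
      · rw [h, pauli_exchange_ketPair_self]
  rw [Heff_mulVec_of_pairExchange n J _ _ (fun i => by split_ifs <;> simp) heigen]
  congr 1
  have hcard : ∑ i, (if ψ i ≠ singlet then (1 : ℂ) else 0) = (z : ℂ) := by
    rw [hz, Finset.sum_boole]
  have hn0 : (n : ℂ) ≠ 0 := Nat.cast_ne_zero.2 (by omega)
  rw [hcard]
  push_cast
  field_simp
  ring
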